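/- arXiv:2006.10519 — 2 statements merged into one kernel-verified Lean document; each statement's English description precedes it below -/
import Mathlib

section
/- Let L be a finite 2-contact system of line segments in the plane ℝ². Then for every ε > 0 there exist a finite generic contact system L′ and a bijection L → L′, written l ↦ l′, such that (i) for all l, m ∈ L one has l ∩ m ≠ ∅ if and only if l′ ∩ m′ ≠ ∅, and (ii) the Hausdorff distance between l and l′ is less than ε for every l ∈ L. -/
noncomputable section

/-- The Euclidean plane. -/
abbrev Pt := EuclideanSpace ℝ (Fin 2)

/-- `S` is a (nondegenerate, closed) line segment in the plane. -/
def IsSeg (S : Set Pt) : Prop := ∃ p q : Pt, p ≠ q ∧ S = segment ℝ p q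

/-- `x` is an endpoint of the segment `S`. -/
def IsEndpt (x : Pt) (S : Set Pt) : Prop :=
  ∃ p q : Pt, p ≠ q ∧ S = segment ℝ p q ∧ (x = p ∨ x = q)

/-- `x` is an interior (relative interior) point of the segment `S`. -/
def IsIntPt (x : Pt) (S : Set Pt) : Prop :=
  ∃ p q : Pt, p ≠ q ∧ S = segment ℝ p q ∧ x ∈ openSegment ℝ p q

/-- A contact system: a collection of (pairwise distinct) segments such that no
point of the plane is an interior point of more than one segment. -/
def IsContactSystem (L : Set (Set Pt)) : Prop :=
  (∀ S ∈ L, IsSeg S) ∧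
  ∀ x : Pt, ∀ S ∈ L, ∀ T ∈ L, IsIntPt x S → IsIntPt x T → S = T

/-- A 2-contact system: a contact system such that every point of the plane
belongs to at most two of the segments. -/
def Is2ContactSystem (L : Set (Set Pt)) : Prop :=
  IsContactSystem L ∧
  ∀ x : Pt, ∀ S ∈ L, ∀ T ∈ L, ∀ U ∈ L,
    x ∈ S → x ∈ T → x ∈ U → (S = T ∨ S = U ∨ T = U)

/-- A generic contact system: a contact system such that moreover no point of
the plane is an endpoint of more than one segment. -/
def IsGenericCS (L : Set (Set Pt)) : Prop :=
  IsContactSystem L ∧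
  ∀ x : Pt, ∀ S ∈ L, ∀ T ∈ L, IsEndpt x S → IsEndpt x T → S = T

/-- `x` is a free endpoint of the family `M`: an endpoint of some segment of `M`
that lies in the interior of no segment of `M`. -/
def IsFreeEndpt (x : Pt) (M : Set (Set Pt)) : Prop :=
  (∃ l ∈ M, IsEndpt x l) ∧ ∀ m ∈ M, ¬ IsIntPt x m

/-- The group of isometries of the plane (every isometry of the plane is affine). -/
abbrev Iso2 := Pt ≃ᵃⁱ[ℝ] Pt

/-- The determinant of the linear part of a plane isometry. -/
def detOf (g : Iso2) : ℝ :=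
  LinearMap.det g.linearIsometryEquiv.toLinearEquiv.toLinearMap

/-- A rotation: a non-identity orientation-preserving isometry with a fixed point. -/
def IsRotation (g : Iso2) : Prop := g ≠ 1 ∧ detOf g = 1 ∧ ∃ x : Pt, g x = x

/-- A reflection: an orientation-reversing isometry with a fixed point. -/
def IsReflection (g : Iso2) : Prop := detOf g ≠ 1 ∧ ∃ x : Pt, g x = x

/-- A translation: the map `x ↦ x + v` for some `v ≠ 0`. -/
def IsTranslation (g : Iso2) : Prop := ∃ v : Pt, v ≠ 0 ∧ ∀ x : Pt, g x = x + v

/-- (S1): the collection `L` of segments is invariant under `Γ`. -/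
def SatS1 (Γ : Subgroup Iso2) (L : Set (Set Pt)) : Prop :=
  ∀ l ∈ L, ∀ g ∈ Γ, (⇑g) '' l ∈ L

/-- (S2): `L` has finitely many `Γ`-orbits. -/
def SatS2 (Γ : Subgroup Iso2) (L : Set (Set Pt)) : Prop :=
  ∃ T : Set (Set Pt), T.Finite ∧ T ⊆ L ∧
    ∀ l ∈ L, ∃ t ∈ T, ∃ g ∈ Γ, (⇑g) '' t = l

/-- (S4): for every `l ∈ L` and every `x ∈ l` the stabiliser of `x` in `Γ` is trivial. -/
def SatS4 (Γ : Subgroup Iso2) (L : Set (Set Pt)) : Prop :=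
  ∀ l ∈ L, ∀ x ∈ l, ∀ g ∈ Γ, g x = x → g = 1

/-- A subgroup of the isometry group of the plane is discrete iff (equivalently,
for subgroups of `Isom(ℝ²)`, in the natural topology) each of its orbits is a
discrete subset of the plane. -/
def IsDiscreteSubgrp (Γ : Subgroup Iso2) : Prop :=
  ∀ x : Pt, DiscreteTopology {y : Pt | ∃ g ∈ Γ, g x = y}

/-- A generic `Γ`-symmetric contact system: satisfies (S1)-(S4). -/
def IsGenSymmCS (Γ : Subgroup Iso2) (L : Set (Set Pt)) : Prop :=
  IsGenericCS L ∧ SatS1 Γ L ∧ SatS2 Γ L ∧ SatS4 Γ L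

end

open Filter Topology

/-- The planar cross product. -/
def cross (a b : Pt) : ℝ := a 0 * b 1 - a 1 * b 0

lemma cross_smul_smul (s t : ℝ) (a b : Pt) : cross (s • a) (t • b) = s * t * cross a b := by
  simp [cross]; ring

lemma cross_neg_left (a b : Pt) : cross (-a) b = -cross a b := by
  simp [cross]; ring

lemma cross_neg_right (a b : Pt) : cross a (-b) = -cross a b := by
  simp [cross]; ring

lemma ext_coords {a b : Pt} (h0 : a 0 = b 0) (h1 : a 1 = b 1) : a = b := by
  ext i; fin_cases i <;> assumption

lemma sq_coords_pos {v : Pt} (hv : v ≠ 0) : 0 < v 0 * v 0 + v 1 * v 1 := by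
  by_contra h
  apply hv
  apply ext_coords <;> simp <;> nlinarith [mul_self_nonneg (v 0), mul_self_nonneg (v 1)]

lemma eq_smul_of_cross_eq_zero {u v : Pt} (hv : v ≠ 0) (h : cross u v = 0) :
    u = ((u 0 * v 0 + u 1 * v 1) / (v 0 * v 0 + v 1 * v 1)) • v := by
  have hp := (sq_coords_pos hv).ne'
  simp only [cross] at h
  apply ext_coords <;> simp only [PiLp.smul_apply, smul_eq_mul] <;>
    rw [div_mul_eq_mul_div, eq_div_iff hp]
  · linear_combination v 1 * h
  · linear_combination -v 0 * h

lemma Filter.Tendsto.cross {f : Filter ℝ} {X Y : ℝ → Pt} {x y : Pt} (hX : Tendsto X f (𝓝 x))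
    (hY : Tendsto Y f (𝓝 y)) : Tendsto (fun t ↦ cross (X t) (Y t)) f (𝓝 (cross x y)) := by
  have hc : Continuous fun p : Pt × Pt ↦ _root_.cross p.1 p.2 := by
    unfold _root_.cross; fun_prop
  exact (hc.tendsto (x, y)).comp (hX.prodMk_nhds hY)

lemma mem_openSegment_iff_exists {x a b : Pt} :
    x ∈ openSegment ℝ a b ↔ ∃ t : ℝ, 0 < t ∧ t < 1 ∧ x = a + t • (b - a) := by
  rw [openSegment_eq_image']
  constructor
  · rintro ⟨t, ⟨h0, h1⟩, rfl⟩; exact ⟨t, h0, h1, rfl⟩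
  · rintro ⟨t, h0, h1, rfl⟩; exact ⟨t, ⟨h0, h1⟩, rfl⟩

lemma mem_openSegment_of_neg_of_pos (g d : Pt) {a c : ℝ} (ha : a < 0) (hc : 0 < c) :
    g ∈ openSegment ℝ (g + a • d) (g + c • d) := by
  rw [mem_openSegment_iff_exists]
  refine ⟨-a / (c - a), div_pos (by linarith) (by linarith), ?_, ?_⟩
  · rw [div_lt_one (by linarith)]; linarith
  · have : c - a ≠ 0 := by linarith
    apply ext_coords <;> simp <;> field_simp <;> ring

/-- A moving point that stays on the line through two moving points and starts strictly between
them remains strictly between them for a while. -/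
lemma eventually_mem_openSegment {f : Filter ℝ} {X A B : ℝ → Pt} {x a b : Pt}
    (hX : Tendsto X f (𝓝 x)) (hA : Tendsto A f (𝓝 a)) (hB : Tendsto B f (𝓝 b)) (hab : a ≠ b)
    (hx : x ∈ openSegment ℝ a b) (hc : ∀ᶠ t in f, cross (X t - A t) (B t - A t) = 0) :
    ∀ᶠ t in f, X t ∈ openSegment ℝ (A t) (B t) := by
  obtain ⟨s, hs0, hs1, rfl⟩ := mem_openSegment_iff_exists.1 hx
  have hd : Tendsto (fun t ↦ B t - A t) f (𝓝 (b - a)) := hB.sub hA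
  have he := hX.sub hA
  have hba : b - a ≠ 0 := sub_ne_zero.2 hab.symm
  have hcoord : ∀ i : Fin 2, ∀ {Y : ℝ → Pt} {y : Pt}, Tendsto Y f (𝓝 y) →
      Tendsto (fun t ↦ Y t i) f (𝓝 (y i)) := fun i Y y h ↦
    ((by fun_prop : Continuous fun p : Pt ↦ p i).tendsto y).comp h
  have hlim := (((hcoord 0 he).mul (hcoord 0 hd)).add ((hcoord 1 he).mul (hcoord 1 hd))).div
    (((hcoord 0 hd).mul (hcoord 0 hd)).add ((hcoord 1 hd).mul (hcoord 1 hd)))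
    (sq_coords_pos hba).ne'
  rw [show _ / _ = s by
    rw [div_eq_iff (sq_coords_pos hba).ne']; simp; ring] at hlim
  filter_upwards [hc, hd.eventually_ne hba, hlim.eventually_lt_const hs1,
    hlim.eventually_const_lt hs0] with t h1 h2 h3 h4
  rw [mem_openSegment_iff_exists]
  exact ⟨_, h4, h3, by
    simpa using sub_eq_iff_eq_add'.1 (eq_smul_of_cross_eq_zero h2 h1)⟩

lemma exists_cross_ne_zero {ι : Type*} [Finite ι] (d : ι → Pt) (hd : ∀ i, d i ≠ 0) :
    ∃ c : Pt, ∀ i, cross (d i) c ≠ 0 := by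
  obtain ⟨M, hM⟩ := (Set.finite_range fun i ↦ d i 1 / d i 0).exists_notMem
  refine ⟨!₂[1, M], fun i h ↦ ?_⟩
  simp only [cross, Matrix.cons_val_zero, Matrix.cons_val_one] at h
  by_cases h0 : d i 0 = 0
  · exact hd i (ext_coords h0 (by simp [h0] at h; simpa using h))
  · exact hM ⟨i, by field_simp; linarith⟩

lemma openSegment_overlap {a b x v : Pt} (hab : a ≠ b) (hx : x ∈ openSegment ℝ a b)
    (hv : cross v (b - a) = 0) : ∃ y ∈ openSegment ℝ x (x + v), y ∈ openSegment ℝ a b := by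
  have hlim : Tendsto (fun t : ℝ ↦ x + t • v) (𝓝[>] 0) (𝓝 (x + (0 : ℝ) • v)) :=
    ((by fun_prop : Continuous fun t : ℝ ↦ x + t • v).tendsto 0).mono_left nhdsWithin_le_nhds
  rw [zero_smul, add_zero] at hlim
  have hx' : cross (x - a) (b - a) = 0 := by
    obtain ⟨s, -, -, rfl⟩ := mem_openSegment_iff_exists.1 hx
    simp [cross]; ring
  have h := eventually_mem_openSegment hlim tendsto_const_nhds tendsto_const_nhds hab hx
    (Eventually.of_forall fun t ↦ by
      simp only [cross, PiLp.sub_apply, PiLp.add_apply, PiLp.smul_apply, smul_eq_mul] at hx' hv ⊢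
      linear_combination hx' + t * hv)
  obtain ⟨t, ht, h0, h1⟩ := (h.and (Ioo_mem_nhdsGT (zero_lt_one' ℝ))).exists
  exact ⟨_, mem_openSegment_iff_exists.2 ⟨t, h0, h1, by simp⟩, ht⟩

lemma eq_or_eq_of_segment_eq {p q p' q' : Pt} (hpq : p ≠ q)
    (h : segment ℝ p q = segment ℝ p' q') : p' = p ∨ p' = q := by
  have hp' : p' ∈ segment ℝ p q := h ▸ left_mem_segment ℝ p' q'
  have hp : p ∈ segment ℝ p' q' := h ▸ left_mem_segment ℝ p q
  have hq : q ∈ segment ℝ p' q' := h ▸ right_mem_segment ℝ p q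
  rw [← insert_endpoints_openSegment] at hp'
  rcases hp' with h1 | h1 | h1
  · exact .inl h1
  · exact .inr h1
  rw [segment_eq_image'] at hp hq
  obtain ⟨s, ⟨hs, -⟩, rfl⟩ := hp
  obtain ⟨t, ⟨ht, -⟩, rfl⟩ := hq
  obtain ⟨r, hr0, hr1, hr⟩ := mem_openSegment_iff_exists.1 h1
  have h2 : ((1 - r) * s + r * t) • (q' - p') = 0 := by
    have : p' + ((1 - r) * s + r * t) • (q' - p') = p' := by
      conv_rhs => rw [hr]
      module
    simpa using this
  rcases smul_eq_zero.1 h2 with h3 | h3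
  · have h4 := mul_nonneg (sub_nonneg.2 hr1.le) hs
    have h5 := mul_nonneg hr0.le ht
    rcases mul_eq_zero.1 (show (1 - r) * s = 0 by linarith) with h6 | h6
    · linarith
    · left; simp [h6]
  · left; simp [h3]

lemma isEndpt_segment {x p q : Pt} (hpq : p ≠ q) (h : IsEndpt x (segment ℝ p q)) :
    x = p ∨ x = q := by
  obtain ⟨p', q', -, h, rfl | rfl⟩ := h
  · exact eq_or_eq_of_segment_eq hpq h
  · exact eq_or_eq_of_segment_eq hpq (h.trans (segment_symm ℝ _ _))

lemma isIntPt_segment {x p q : Pt} (hpq : p ≠ q) (h : IsIntPt x (segment ℝ p q)) :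
    x ∈ openSegment ℝ p q := by
  obtain ⟨p', q', hne, h, hx⟩ := h
  have hq' := eq_or_eq_of_segment_eq hpq (h.trans (segment_symm ℝ p' q'))
  rcases eq_or_eq_of_segment_eq hpq h with rfl | rfl <;> rcases hq' with rfl | rfl
  · exact absurd rfl hne
  · exact hx
  · rwa [openSegment_symm]
  · exact absurd rfl hne

/-- The segments of a family whose ends are recorded by `E`. -/
def famSeg {ι : Type*} (E : ι → Bool → Pt) (l : ι) : Set Pt := segment ℝ (E l false) (E l true)

/-- The relative interiors of the segments of a family. -/
def famInt {ι : Type*} (E : ι → Bool → Pt) (l : ι) : Set Pt :=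
  openSegment ℝ (E l false) (E l true)

/-- The direction vectors of the segments of a family. -/
def famDir {ι : Type*} (E : ι → Bool → Pt) (l : ι) : Pt := E l true - E l false

section Family

variable {ι : Type*} {E : ι → Bool → Pt}

lemma famSeg_eq (l : ι) (b : Bool) : famSeg E l = segment ℝ (E l b) (E l !b) := by
  cases b
  · rfl
  · exact segment_symm ℝ _ _

lemma famInt_eq (l : ι) (b : Bool) : famInt E l = openSegment ℝ (E l b) (E l !b) := by
  cases b
  · rfl
  · exact openSegment_symm ℝ _ _

lemma mem_famSeg_end (l : ι) (b : Bool) : E l b ∈ famSeg E l := by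
  rw [famSeg_eq l b]; exact left_mem_segment ℝ _ _

lemma famInt_subset (l : ι) : famInt E l ⊆ famSeg E l := openSegment_subset_segment ℝ _ _

lemma mem_famSeg_iff {l : ι} {x : Pt} :
    x ∈ famSeg E l ↔ (∃ b, x = E l b) ∨ x ∈ famInt E l := by
  rw [famSeg, ← insert_endpoints_openSegment, famInt]
  simp [or_assoc]

lemma end_notMem_famInt {l : ι} (h : E l false ≠ E l true) (b : Bool) : E l b ∉ famInt E l := by
  have h' : E l b ≠ E l !b := by cases b <;> simp [h, h.symm]
  rw [famInt_eq l b]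
  intro hm
  obtain ⟨t, h0, -, ht⟩ := mem_openSegment_iff_exists.1 hm
  rcases smul_eq_zero.1 (left_eq_add.1 ht) with h1 | h1
  · exact h0.ne' h1
  · exact h' (sub_eq_zero.1 h1).symm

/-- In a family of segments with pairwise disjoint interiors, an end of one segment lies in the
interior of another one only transversally. -/
lemma cross_famDir_ne_zero (hne : ∀ l, E l false ≠ E l true)
    (hint : ∀ x l m, x ∈ famInt E l → x ∈ famInt E m → l = m) {l m : ι} (hlm : l ≠ m) {b : Bool}
    (hx : E l b ∈ famInt E m) : cross (famDir E l) (famDir E m) ≠ 0 := by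
  intro h
  have h' : cross (E l (!b) - E l b) (E m true - E m false) = 0 := by
    cases b
    · exact h
    · rw [← neg_sub, cross_neg_left]
      simpa [famDir] using h
  obtain ⟨y, hy, hy'⟩ := openSegment_overlap (hne m) hx h'
  rw [add_sub_cancel, ← famInt_eq] at hy
  exact hlm (hint y l m hy hy')

/-- Two segments meet transversally, at an end of one of them which is interior to the other. -/
def TouchTransversally (E : ι → Bool → Pt) (l m : ι) : Prop :=
  cross (famDir E l) (famDir E m) ≠ 0 ∧ ∃ b, E l b ∈ famInt E m ∨ E m b ∈ famInt E l

lemma TouchTransversally.symm {l m : ι} (h : TouchTransversally E l m) :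
    TouchTransversally E m l := by
  obtain ⟨h, b, hb⟩ := h
  refine ⟨fun h' ↦ h ?_, b, hb.symm⟩
  simp only [cross] at h' ⊢
  linarith

lemma TouchTransversally.inter_nonempty {l m : ι} (h : TouchTransversally E l m) :
    (famSeg E l ∩ famSeg E m).Nonempty := by
  obtain ⟨-, b, hb | hb⟩ := h
  · exact ⟨_, mem_famSeg_end l b, famInt_subset m hb⟩
  · exact ⟨_, famInt_subset l hb, mem_famSeg_end m b⟩

lemma cross_eq_zero_of_mem_famSeg {l : ι} {x y : Pt} (hx : x ∈ famSeg E l) (hy : y ∈ famSeg E l) :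
    cross (x - y) (famDir E l) = 0 := by
  rw [famSeg, segment_eq_image'] at hx hy
  obtain ⟨s, -, rfl⟩ := hx
  obtain ⟨t, -, rfl⟩ := hy
  simp [cross, famDir]; ring

lemma eq_of_mem_famSeg_of_cross_ne_zero {l m : ι} (h : cross (famDir E l) (famDir E m) ≠ 0) {x y : Pt}
    (hxl : x ∈ famSeg E l) (hxm : x ∈ famSeg E m) (hyl : y ∈ famSeg E l) (hym : y ∈ famSeg E m) :
    x = y := by
  have h1 := cross_eq_zero_of_mem_famSeg hxl hyl
  have h2 := cross_eq_zero_of_mem_famSeg hxm hym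
  simp only [cross] at h h1 h2
  rw [← sub_eq_zero]
  apply ext_coords <;> apply mul_left_cancel₀ h
  · simp only [PiLp.zero_apply, mul_zero]
    linear_combination famDir E l 0 * h2 - famDir E m 0 * h1
  · simp only [PiLp.zero_apply, mul_zero]
    linear_combination famDir E l 1 * h2 - famDir E m 1 * h1

/-- A point common to two touching segments is not interior to both, nor an end of both. -/
lemma TouchTransversally.not_both {l m : ι}
    (h : TouchTransversally E l m) {x : Pt} (hl : x ∈ famSeg E l) (hm : x ∈ famSeg E m) :
    (∃ b, x = E l b) ∧ x ∈ famInt E m ∨ (∃ b, x = E m b) ∧ x ∈ famInt E l := by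
  obtain ⟨h, b, hb | hb⟩ := h
  · obtain rfl := eq_of_mem_famSeg_of_cross_ne_zero h hl hm (mem_famSeg_end l b) (famInt_subset m hb)
    exact .inl ⟨⟨b, rfl⟩, hb⟩
  · obtain rfl := eq_of_mem_famSeg_of_cross_ne_zero h hl hm (famInt_subset l hb) (mem_famSeg_end m b)
    exact .inr ⟨⟨b, rfl⟩, hb⟩

lemma exists_dist_le_of_mem_segment {a b a' b' x : Pt} {r : ℝ} (ha : dist a a' ≤ r)
    (hb : dist b b' ≤ r) (hx : x ∈ segment ℝ a b) : ∃ y ∈ segment ℝ a' b', dist x y ≤ r := by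
  obtain ⟨s, t, hs, ht, hst, rfl⟩ := hx
  refine ⟨s • a' + t • b', ⟨s, t, hs, ht, hst, rfl⟩, ?_⟩
  calc dist (s • a + t • b) (s • a' + t • b')
      ≤ dist (s • a) (s • a') + dist (t • b) (t • b') := dist_add_add_le _ _ _ _
    _ = s * dist a a' + t * dist b b' := by
      rw [dist_smul₀, dist_smul₀, Real.norm_of_nonneg hs, Real.norm_of_nonneg ht]
    _ ≤ s * r + t * r := by gcongr
    _ = r := by rw [← add_mul, hst, one_mul]

lemma hausdorffDist_segment_le {a b a' b' : Pt} {r : ℝ} (ha : dist a a' ≤ r)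
    (hb : dist b b' ≤ r) : Metric.hausdorffDist (segment ℝ a b) (segment ℝ a' b') ≤ r := by
  refine Metric.hausdorffDist_le_of_mem_dist (dist_nonneg.trans ha)
    (fun x hx ↦ exists_dist_le_of_mem_segment ha hb hx)
    (fun x hx ↦ exists_dist_le_of_mem_segment ?_ ?_ hx)
  · rwa [dist_comm]
  · rwa [dist_comm]

lemma isCompact_famSeg (l : ι) : IsCompact (famSeg E l) := by
  rw [famSeg, segment_eq_image']
  exact isCompact_Icc.image (by fun_prop)

/-- Disjoint segments stay disjoint under small perturbations of their ends. -/
lemma eventually_disjoint_famSeg {f : Filter ℝ} {F : ℝ → ι → Bool → Pt}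
    (hF : ∀ l b, Tendsto (fun t ↦ F t l b) f (𝓝 (E l b))) {l m : ι}
    (h : Disjoint (famSeg E l) (famSeg E m)) :
    ∀ᶠ t in f, Disjoint (famSeg (F t) l) (famSeg (F t) m) := by
  obtain ⟨r, hr, hd⟩ := h.exists_thickenings (isCompact_famSeg l) (isCompact_famSeg m).isClosed
  have key : ∀ k, ∀ᶠ t in f, famSeg (F t) k ⊆ Metric.thickening r (famSeg E k) := by
    intro k
    have hk : ∀ b, ∀ᶠ t in f, F t k b ∈ Metric.thickening r (famSeg E k) := fun b ↦
      (hF k b).eventually_mem (Metric.isOpen_thickening.mem_nhds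
        (Metric.self_subset_thickening hr _ (mem_famSeg_end k b)))
    filter_upwards [hk false, hk true] with t h0 h1
    exact ((convex_segment _ _).thickening r).segment_subset h0 h1
  filter_upwards [key l, key m] with t hl hm
  exact hd.mono hl hm

/-- The ends of a family of segments, bent along a parabola with axis direction `c`. -/
def bend (E : ι → Bool → Pt) (c : Pt) (δ : ℝ) (l : ι) (b : Bool) : Pt :=
  E l b + (δ * (E l b 0 * E l b 0 + E l b 1 * E l b 1)) • c

/-- Slide the end `b` of each segment along the line of this segment by the proportion `α l b`. -/
def slide (G : ι → Bool → Pt) (α : ι → Bool → ℝ) (l : ι) (b : Bool) : Pt :=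
  G l b + α l b • (G l (!b) - G l b)

lemma tendsto_bend (c : Pt) (l : ι) (b : Bool) :
    Tendsto (fun δ ↦ bend E c δ l b) (𝓝[>] 0) (𝓝 (E l b)) := by
  have h : Continuous fun δ ↦ bend E c δ l b := by unfold bend; fun_prop
  have h0 := (h.tendsto 0).mono_left (nhdsWithin_le_nhds (s := Set.Ioi 0))
  simpa [bend] using h0

lemma tendsto_famDir {f : Filter ℝ} {F : ℝ → ι → Bool → Pt}
    (hF : ∀ l b, Tendsto (fun t ↦ F t l b) f (𝓝 (E l b))) (l : ι) :
    Tendsto (fun t ↦ famDir (F t) l) f (𝓝 (famDir E l)) := (hF l true).sub (hF l false)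

lemma famDir_slide (G : ι → Bool → Pt) (α : ι → Bool → ℝ) (l : ι) :
    famDir (slide G α) l = (1 - α l true - α l false) • famDir G l := by
  simp only [famDir, slide, Bool.not_true, Bool.not_false]
  module

lemma tendsto_slide {f : Filter ℝ} {G : ℝ → ι → Bool → Pt} {α : ℝ → ι → Bool → ℝ}
    (hG : ∀ l b, Tendsto (fun t ↦ G t l b) f (𝓝 (E l b)))
    (hα : ∀ l b, Tendsto (fun t ↦ α t l b) f (𝓝 0)) (l : ι) (b : Bool) :
    Tendsto (fun t ↦ slide (G t) (α t) l b) f (𝓝 (E l b)) := by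
  simpa [slide] using (hG l b).add ((hα l b).smul ((hG l !b).sub (hG l b)))

/-- Bending turns segments with a common end into transversal ones. -/
lemma eventually_cross_bend_ne_zero (hne : ∀ l, E l false ≠ E l true) {c : Pt}
    (hc : ∀ l, cross (famDir E l) c ≠ 0) {l m : ι} (hlm : famSeg E l ≠ famSeg E m) {b b' : Bool}
    (h : E l b = E m b') :
    ∀ᶠ δ in 𝓝[>] 0, cross (famDir (bend E c δ) l) (famDir (bend E c δ) m) ≠ 0 := by
  by_cases h0 : cross (famDir E l) (famDir E m) = 0
  swap
  · exact ((tendsto_famDir (tendsto_bend c) l).cross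
      (tendsto_famDir (tendsto_bend c) m)).eventually_ne h0
  have hdir : ∀ (F : ι → Bool → Pt) (k : ι) (a : Bool),
      famDir F k = F k (!a) - F k a ∨ famDir F k = -(F k (!a) - F k a) := by
    intro F k a; cases a <;> simp [famDir]
  have hcross : ∀ F : ι → Bool → Pt, cross (famDir F l) (famDir F m) = 0 →
      cross (F l (!b) - F l b) (F m (!b') - F m b') = 0 := by
    intro F hF
    rcases hdir F l b with h1 | h1 <;> rcases hdir F m b' with h2 | h2 <;>
      rw [h1, h2] at hF <;> simpa only [cross_neg_left, cross_neg_right, neg_eq_zero] using hF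
  have hu : E l (!b) - E l b ≠ 0 := by
    rw [sub_ne_zero]; cases b <;> simp [hne, (hne _).symm]
  have hv : E m (!b') - E m b' ≠ 0 := by
    rw [sub_ne_zero]; cases b' <;> simp [hne, (hne _).symm]
  have huc : cross (E l (!b) - E l b) c ≠ 0 := by
    have hcl := hc l
    rcases hdir E l b with h1 | h1 <;> rw [h1] at hcl
    · exact hcl
    · rwa [cross_neg_left, neg_ne_zero] at hcl
  have hvu := eq_smul_of_cross_eq_zero hu (u := E m (!b') - E m b') (by
    have := hcross E h0
    simp only [cross] at this ⊢; linarith)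
  obtain ⟨k, hvu⟩ : ∃ k : ℝ, E m (!b') - E m b' = k • (E l (!b) - E l b) := ⟨_, hvu⟩
  have hk0 : k ≠ 0 := by rintro rfl; exact hv (by rw [hvu, zero_smul])
  have hk1 : k ≠ 1 := by
    rintro rfl
    apply hlm
    rw [famSeg_eq l b, famSeg_eq m b', h]
    rw [one_smul, h] at hvu
    rw [sub_left_injective hvu]
  filter_upwards [self_mem_nhdsWithin] with δ hδ hzero
  have h1 := hcross _ hzero
  have hE : E m (!b') = E l b + k • (E l (!b) - E l b) := by
    rw [← hvu, h]; abel
  have h2 : δ * (k * (k - 1)) * ((E l (!b) - E l b) 0 * (E l (!b) - E l b) 0 +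
      (E l (!b) - E l b) 1 * (E l (!b) - E l b) 1) * cross (E l (!b) - E l b) c = 0 := by
    rw [← h1, bend, bend, bend, bend, ← h, hE]
    simp [cross]; ring
  have := sq_coords_pos hu
  have hδ' : δ ≠ 0 := ne_of_gt hδ
  exact mul_ne_zero (mul_ne_zero (mul_ne_zero hδ' (mul_ne_zero hk0 (sub_ne_zero.2 hk1))) this.ne')
    huc h2

lemma exists_slide_param (hne : ∀ l, E l false ≠ E l true)
    (hint : ∀ x l m, x ∈ famInt E l → x ∈ famInt E m → l = m) (r : ι → ℕ) (c : Pt) (l : ι)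
    (b : Bool) :
    ∃ a : ℝ → ℝ, Tendsto a (𝓝[>] 0) (𝓝 0) ∧
      (∀ m, E l b ∈ famInt E m → ∀ᶠ δ in 𝓝[>] 0,
        cross (bend E c δ l b + a δ • (bend E c δ l (!b) - bend E c δ l b) - bend E c δ m false)
          (famDir (bend E c δ) m) = 0) ∧
      ((∀ m, E l b ∉ famInt E m) → (∃ m b', r m < r l ∧ E m b' = E l b) → ∀ δ > 0, a δ < 0) ∧
      ((∀ m, E l b ∉ famInt E m) → (¬ ∃ m b', r m < r l ∧ E m b' = E l b) → ∀ δ, a δ = 0) := by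
  by_cases hm : ∃ m, E l b ∈ famInt E m
  · obtain ⟨m, hm⟩ := hm
    have hlm : l ≠ m := by rintro rfl; exact end_notMem_famInt (hne l) b hm
    have hcr : cross (E l (!b) - E l b) (famDir E m) ≠ 0 := by
      have h := cross_famDir_ne_zero hne hint hlm hm
      cases b
      · exact h
      · rw [← neg_sub, cross_neg_left, neg_ne_zero]; exact h
    have hG := tendsto_bend (E := E) c
    have hden := ((hG l !b).sub (hG l b)).cross (tendsto_famDir hG m)
    have hnum := ((hG l b).sub (hG m false)).cross (tendsto_famDir hG m)
    have h0 := cross_eq_zero_of_mem_famSeg (famInt_subset m hm) (mem_famSeg_end m false)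
    refine ⟨fun δ ↦ -cross (bend E c δ l b - bend E c δ m false) (famDir (bend E c δ) m) /
      cross (bend E c δ l (!b) - bend E c δ l b) (famDir (bend E c δ) m), ?_, ?_,
      fun h ↦ absurd hm (h m), fun h ↦ absurd hm (h m)⟩
    · have hlim := hnum.neg.div hden hcr
      rwa [h0, neg_zero, zero_div] at hlim
    · intro m' hm'
      obtain rfl := hint _ _ _ hm hm'
      filter_upwards [hden.eventually_ne hcr] with δ hδ
      have key : ∀ (g d w e : Pt) (t : ℝ),
          cross (g + t • d - w) e = cross (g - w) e + t * cross d e := by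
        intros; simp [cross]; ring
      rw [key, div_mul_cancel₀ _ hδ, add_neg_cancel]
  · push Not at hm
    by_cases h : ∃ m b', r m < r l ∧ E m b' = E l b
    · refine ⟨fun δ ↦ -δ, ?_, fun m h ↦ absurd h (hm m), fun _ _ δ hδ ↦ by simpa using hδ,
        fun _ h' ↦ absurd h h'⟩
      have := (continuous_neg (G := ℝ)).tendsto 0
      rw [neg_zero] at this
      exact this.mono_left nhdsWithin_le_nhds
    · exact ⟨fun _ ↦ 0, tendsto_const_nhds, fun m h ↦ absurd h (hm m), fun _ h' ↦ absurd h' h,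
        fun _ _ _ ↦ rfl⟩

/-- Near an end that is slid outwards, the old end becomes an interior point. -/
lemma mem_famInt_slide {G : ι → Bool → Pt} {α : ι → Bool → ℝ} {l : ι} {b : Bool}
    (h : α l b < 0) (h' : α l (!b) < 1) : G l b ∈ famInt (slide G α) l := by
  rw [famInt_eq l b]
  have := mem_openSegment_of_neg_of_pos (G l b) (G l (!b) - G l b) h (sub_pos.2 h')
  convert this using 1
  simp only [slide, Bool.not_not]
  congr 1
  module

lemma exists_common_end_or_end_mem_famInt
    (hint : ∀ x l m, x ∈ famInt E l → x ∈ famInt E m → l = m) {l m : ι} (hlm : l ≠ m)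
    (h : (famSeg E l ∩ famSeg E m).Nonempty) :
    (∃ b b', E l b = E m b') ∨ (∃ b, E l b ∈ famInt E m) ∨ ∃ b, E m b ∈ famInt E l := by
  obtain ⟨x, hl, hm⟩ := h
  rcases mem_famSeg_iff.1 hl with ⟨b, rfl⟩ | hl' <;> rcases mem_famSeg_iff.1 hm with ⟨b', hb'⟩ | hm'
  · exact .inl ⟨b, b', hb'⟩
  · exact .inr (.inl ⟨b, hm'⟩)
  · exact .inr (.inr ⟨b', hb' ▸ hl'⟩)
  · exact absurd (hint x l m hl' hm') hlm

lemma exists_touching_perturbation [Finite ι] (hne : ∀ l, E l false ≠ E l true)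
    (hinj : Function.Injective (famSeg E))
    (hint : ∀ x l m, x ∈ famInt E l → x ∈ famInt E m → l = m)
    (htwo : ∀ x l m k, x ∈ famSeg E l → x ∈ famSeg E m → x ∈ famSeg E k → l = m ∨ l = k ∨ m = k)
    {ε : ℝ} (hε : 0 < ε) :
    ∃ F : ι → Bool → Pt, (∀ l b, dist (E l b) (F l b) < ε) ∧ (∀ l, F l false ≠ F l true) ∧
      ∀ l m, l ≠ m → (Disjoint (famSeg E l) (famSeg E m) → Disjoint (famSeg F l) (famSeg F m)) ∧
        ((famSeg E l ∩ famSeg E m).Nonempty → TouchTransversally F l m) := by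
  obtain ⟨r, hr⟩ := Countable.exists_injective_nat ι
  obtain ⟨c, hc⟩ := exists_cross_ne_zero (famDir E) fun l ↦ sub_ne_zero.2 (hne l).symm
  choose a ha hline hneg hzero using exists_slide_param hne hint r c
  let G := bend E c
  let F : ℝ → ι → Bool → Pt := fun δ ↦ slide (G δ) fun l b ↦ a l b δ
  have hG : ∀ l b, Tendsto (fun δ ↦ G δ l b) (𝓝[>] 0) (𝓝 (E l b)) := tendsto_bend c
  have hF : ∀ l b, Tendsto (fun δ ↦ F δ l b) (𝓝[>] 0) (𝓝 (E l b)) := tendsto_slide hG ha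
  have hdir : ∀ δ l, famDir (F δ) l = (1 - a l true δ - a l false δ) • famDir (G δ) l :=
    fun δ l ↦ famDir_slide _ _ l
  have hscale : ∀ l, ∀ᶠ δ in 𝓝[>] 0, 1 - a l true δ - a l false δ ≠ 0 := by
    intro l
    have := ((tendsto_const_nhds (x := (1 : ℝ))).sub (ha l true)).sub (ha l false)
    exact this.eventually_ne (by norm_num)
  -- an end in the interior of another segment stays there
  have htouch_int : ∀ l m b, l ≠ m → E l b ∈ famInt E m →
      ∀ᶠ δ in 𝓝[>] 0, TouchTransversally (F δ) l m := by
    intro l m b hlm hb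
    have hcr := cross_famDir_ne_zero hne hint hlm hb
    have hmem := eventually_mem_openSegment (hF l b) (hF m false) (hF m true) (hne m) hb (by
      filter_upwards [hline l b m hb] with δ hδ
      have e1 : F δ m false = G δ m false + a m false δ • famDir (G δ) m := rfl
      have e2 : F δ m true - F δ m false = _ := hdir δ m
      have e3 : F δ l b = bend E c δ l b +
        a l b δ • (bend E c δ l (!b) - bend E c δ l b) := rfl
      rw [← e3] at hδ
      rw [e2, e1]
      change cross (F δ l b - G δ m false) (famDir (G δ) m) = 0 at hδ
      simp only [cross, PiLp.sub_apply, PiLp.add_apply, PiLp.smul_apply, smul_eq_mul] at hδ ⊢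
      linear_combination (1 - a m true δ - a m false δ) * hδ)
    filter_upwards [hmem, ((tendsto_famDir hF l).cross (tendsto_famDir hF m)).eventually_ne hcr]
      with δ h1 h2
    exact ⟨h2, b, .inl h1⟩
  -- of two segments with a common end, the later one is prolonged beyond this end
  have htouch_end : ∀ l m b b', r l < r m → E l b = E m b' →
      ∀ᶠ δ in 𝓝[>] 0, TouchTransversally (F δ) l m := by
    intro l m b b' hlt hb
    have hlm : l ≠ m := by rintro rfl; exact lt_irrefl _ hlt
    have hfree : ∀ k, E l b ∉ famInt E k := by
      intro k hk
      rcases htwo _ l m k (mem_famSeg_end l b) (hb ▸ mem_famSeg_end m b') (famInt_subset k hk) with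
        h | rfl | rfl
      · exact hlm h
      · exact end_notMem_famInt (hne l) b hk
      · exact end_notMem_famInt (hne m) b' (hb ▸ hk)
    have hl := hzero l b hfree (by
      rintro ⟨k, b'', hk, hkl⟩
      rcases htwo _ l m k (mem_famSeg_end l b) (hb ▸ mem_famSeg_end m b')
        (hkl ▸ mem_famSeg_end k b'') with h | rfl | rfl
      · exact hlm h
      · exact lt_irrefl _ hk
      · exact lt_asymm hlt hk)
    have hm := hneg m b' (hb ▸ hfree) ⟨l, b, hlt, hb⟩
    filter_upwards [self_mem_nhdsWithin, (ha m (!b')).eventually_lt_const zero_lt_one, hscale l,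
      hscale m, eventually_cross_bend_ne_zero hne hc (hinj.ne hlm) hb] with δ h1 h2 h3 h4 h5
    refine ⟨?_, ?_⟩
    · rw [hdir, hdir, cross_smul_smul]
      exact mul_ne_zero (mul_ne_zero h3 h4) h5
    · have hmem := mem_famInt_slide (G := G δ) (α := fun l b ↦ a l b δ) (hm δ h1) h2
      have e : F δ l b = G δ m b' := by
        simp only [F, slide, hl, G, bend, hb]; simp
      exact ⟨b, .inl (e ▸ hmem)⟩
  have hpair : ∀ l m, l ≠ m → ∀ᶠ δ in 𝓝[>] 0,
      (Disjoint (famSeg E l) (famSeg E m) → Disjoint (famSeg (F δ) l) (famSeg (F δ) m)) ∧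
        ((famSeg E l ∩ famSeg E m).Nonempty → TouchTransversally (F δ) l m) := by
    intro l m hlm
    by_cases hd : Disjoint (famSeg E l) (famSeg E m)
    · filter_upwards [eventually_disjoint_famSeg hF hd] with δ hδ
      exact ⟨fun _ ↦ hδ, fun h ↦ absurd hd (Set.not_disjoint_iff_nonempty_inter.2 h)⟩
    · have : ∀ᶠ δ in 𝓝[>] 0, TouchTransversally (F δ) l m := by
        rcases exists_common_end_or_end_mem_famInt hint hlm
          (Set.not_disjoint_iff_nonempty_inter.1 hd) with ⟨b, b', h⟩ | ⟨b, h⟩ | ⟨b, h⟩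
        · rcases lt_or_gt_of_ne (hr.ne hlm) with hlt | hlt
          · exact htouch_end l m b b' hlt h
          · exact (htouch_end m l b' b hlt h.symm).mono fun δ ↦ TouchTransversally.symm
        · exact htouch_int l m b hlm h
        · exact (htouch_int m l b hlm.symm h).mono fun δ ↦ TouchTransversally.symm
      filter_upwards [this] with δ hδ
      exact ⟨fun h ↦ absurd h hd, fun _ ↦ hδ⟩
  have hdist : ∀ l b, ∀ᶠ δ in 𝓝[>] 0, dist (E l b) (F δ l b) < ε := fun l b ↦ by
    simpa only [dist_comm] using (hF l b).eventually (Metric.ball_mem_nhds _ hε)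
  have hne' : ∀ l, ∀ᶠ δ in 𝓝[>] 0, F δ l false ≠ F δ l true := fun l ↦ by
    filter_upwards [(tendsto_famDir hF l).eventually_ne (sub_ne_zero.2 (hne l).symm)] with δ hδ
    exact (sub_ne_zero.1 hδ).symm
  obtain ⟨δ, h1, h2, h3⟩ := ((eventually_all.2 fun l ↦ eventually_all.2 (hdist l)).and
    ((eventually_all.2 hne').and (eventually_all.2 fun l ↦ eventually_all.2 fun m ↦
      eventually_imp_distrib_left.2 (hpair l m)))).exists
  exact ⟨F δ, h1, h2, h3⟩

/-- A family in which any two segments are disjoint or touch transversally is a generic contact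
system. -/
lemma isGenericCS_range (hne : ∀ l, E l false ≠ E l true)
    (h : ∀ l m, l ≠ m → (famSeg E l ∩ famSeg E m).Nonempty → TouchTransversally E l m) :
    IsGenericCS (Set.range (famSeg E)) := by
  refine ⟨⟨?_, ?_⟩, ?_⟩
  · rintro _ ⟨l, rfl⟩
    exact ⟨_, _, hne l, rfl⟩
  · rintro x _ ⟨l, rfl⟩ _ ⟨m, rfl⟩ hl hm
    by_contra hlm
    have hl' : x ∈ famInt E l := isIntPt_segment (hne l) hl
    have hm' : x ∈ famInt E m := isIntPt_segment (hne m) hm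
    have ht := h l m (fun e ↦ hlm (e ▸ rfl)) ⟨x, famInt_subset l hl', famInt_subset m hm'⟩
    rcases ht.not_both (famInt_subset l hl') (famInt_subset m hm') with
      ⟨⟨b, rfl⟩, -⟩ | ⟨⟨b, rfl⟩, -⟩
    · exact end_notMem_famInt (hne l) b hl'
    · exact end_notMem_famInt (hne m) b hm'
  · rintro x _ ⟨l, rfl⟩ _ ⟨m, rfl⟩ hl hm
    by_contra hlm
    have hend : ∀ k, IsEndpt x (famSeg E k) → ∃ b, x = E k b := by
      intro k hk
      rcases isEndpt_segment (hne k) hk with e | e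
      exacts [⟨_, e⟩, ⟨_, e⟩]
    obtain ⟨b, rfl⟩ := hend l hl
    obtain ⟨b', hb'⟩ := hend m hm
    have hm' : E l b ∈ famSeg E m := hb' ▸ mem_famSeg_end m b'
    have ht := h l m (fun e ↦ hlm (e ▸ rfl)) ⟨_, mem_famSeg_end l b, hm'⟩
    rcases ht.not_both (mem_famSeg_end l b) hm' with ⟨-, h1⟩ | ⟨-, h1⟩
    · exact end_notMem_famInt (hne m) b' (hb' ▸ h1)
    · exact end_notMem_famInt (hne l) b h1

end Family

/-- Every finite 2-contact system can be perturbed, by an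
arbitrarily small amount in Hausdorff distance, to a generic contact system
with the same intersection pattern. -/
theorem stmt_0 (L : Set (Set Pt)) (hfin : L.Finite) (hL : Is2ContactSystem L)
    {ε : ℝ} (hε : 0 < ε) :
    ∃ (L' : Set (Set Pt)) (φ : Set Pt → Set Pt),
      L'.Finite ∧ IsGenericCS L' ∧ Set.BijOn φ L L' ∧
      (∀ l ∈ L, ∀ m ∈ L, ((l ∩ m).Nonempty ↔ (φ l ∩ φ m).Nonempty)) ∧
      (∀ l ∈ L, Metric.hausdorffDist l (φ l) < ε) := by
  classical
  have := hfin.to_subtype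
  choose p q hpq hseg using fun l : L ↦ hL.1.1 l l.2
  let E : L → Bool → Pt := fun l b ↦ cond b (q l) (p l)
  have hE : ∀ l : L, famSeg E l = l := fun l ↦ (hseg l).symm
  have hIE : ∀ x (l : L), x ∈ famInt E l → IsIntPt x l := fun x l hx ↦
    ⟨p l, q l, hpq l, hseg l, hx⟩
  obtain ⟨F, hdist, hneF, hF⟩ := exists_touching_perturbation (E := E) hpq
    (fun l m h ↦ Subtype.ext (by rw [← hE l, ← hE m, h]))
    (fun x l m hl hm ↦ Subtype.ext (hL.1.2 x l l.2 m m.2 (hIE x l hl) (hIE x m hm)))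
    (fun x l m k hl hm hk ↦ by
      rw [hE] at hl hm hk
      simpa only [Subtype.ext_iff] using hL.2 x l l.2 m m.2 k k.2 hl hm hk) (half_pos hε)
  have hiff : ∀ l m : L, l ≠ m →
      ((famSeg E l ∩ famSeg E m).Nonempty ↔ (famSeg F l ∩ famSeg F m).Nonempty) := fun l m hlm ↦
    ⟨fun h ↦ ((hF l m hlm).2 h).inter_nonempty, fun h ↦ by
      by_contra hd
      rw [← Set.not_disjoint_iff_nonempty_inter] at h hd
      exact h ((hF l m hlm).1 (not_not.1 hd))⟩
  have htouch : ∀ l m, l ≠ m → (famSeg F l ∩ famSeg F m).Nonempty → TouchTransversally F l m :=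
    fun l m hlm h ↦ (hF l m hlm).2 ((hiff l m hlm).2 h)
  have hinj : Function.Injective (famSeg F) := by
    intro l m h
    by_contra hlm
    have hs : ∀ b, F l b ∈ famSeg F m := fun b ↦ h ▸ mem_famSeg_end l b
    have ht := htouch l m hlm ⟨_, mem_famSeg_end l false, hs false⟩
    exact hneF l (eq_of_mem_famSeg_of_cross_ne_zero ht.1 (mem_famSeg_end l false) (hs false)
      (mem_famSeg_end l true) (hs true))
  let φ : Set Pt → Set Pt := fun l ↦ if h : l ∈ L then famSeg F ⟨l, h⟩ else ∅
  have hφ : ∀ l : L, φ l = famSeg F l := fun l ↦ by simp [φ]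
  refine ⟨Set.range (famSeg F), φ, Set.finite_range _, isGenericCS_range hneF htouch,
    ⟨?_, ?_, ?_⟩, ?_, ?_⟩
  · intro l hl
    exact ⟨⟨l, hl⟩, (hφ ⟨l, hl⟩).symm⟩
  · intro l hl m hm h
    have h' : famSeg F ⟨l, hl⟩ = famSeg F ⟨m, hm⟩ := by rw [← hφ, ← hφ]; exact h
    exact congrArg Subtype.val (hinj h')
  · rintro _ ⟨l, rfl⟩
    exact ⟨l, l.2, hφ l⟩
  · intro l hl m hm
    by_cases hlm : l = m
    · subst hlm
      rw [Set.inter_self, Set.inter_self, hφ ⟨l, hl⟩]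
      have hl' := mem_famSeg_end (E := E) ⟨l, hl⟩ false
      rw [hE] at hl'
      exact ⟨fun _ ↦ ⟨_, mem_famSeg_end _ false⟩, fun _ ↦ ⟨_, hl'⟩⟩
    · have := hiff ⟨l, hl⟩ ⟨m, hm⟩ (by simpa using hlm)
      rwa [hE, hE, ← hφ, ← hφ] at this
  · intro l hl
    rw [hφ ⟨l, hl⟩]
    have := hausdorffDist_segment_le (hdist ⟨l, hl⟩ false).le (hdist ⟨l, hl⟩ true).le
    change Metric.hausdorffDist (famSeg E ⟨l, hl⟩) (famSeg F ⟨l, hl⟩) ≤ _ at this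
    rw [hE] at this
    linarith
end

section
/- Let t be the translation of ℝ² by a nonzero vector and let Γ = { tⁿ : n ∈ ℤ } be the infinite cyclic group it generates. Let L be a generic Γ-symmetric contact system of line segments in ℝ². Then for every nonempty Γ-invariant subset M ⊆ L, the set of free endpoints of M (endpoints of segments of M not lying in the interior of any segment of M) meets at least two distinct Γ-orbits; that is, there exist free endpoints p, q of M with q ∉ { tⁿ(p) : n ∈ ℤ }. -/
lemma isIntPt_of_mem_openSegment {x p q : Pt} (hpq : p ≠ q) (hx : x ∈ openSegment ℝ p q) :
    IsIntPt x (segment ℝ p q) := ⟨p, q, hpq, rfl, hx⟩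

/-- An endpoint of a segment is not in its relative interior. -/
lemma right_not_mem_openSegment_of_segment_eq {p q a b : Pt} (hab : a ≠ b)
    (h : segment ℝ p q = segment ℝ a b) : q ∉ openSegment ℝ a b := by
  intro hq
  have ha : a ∈ segment ℝ p q := h ▸ left_mem_segment ℝ a b
  have hb : b ∈ segment ℝ p q := h ▸ right_mem_segment ℝ a b
  have hext := (mem_extremePoints_iff_left (𝕜 := ℝ)).1
    (show q ∈ (segment ℝ p q).extremePoints ℝ from ?_)
  · have h1 := hext.2 a ha b hb hq
    have h2 := hext.2 b hb a ha (openSegment_symm ℝ a b ▸ hq)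
    exact hab (h1.trans h2.symm)
  · refine (mem_extremePoints_iff_left (𝕜 := ℝ)).2 ⟨right_mem_segment ℝ p q, ?_⟩
    rintro x hx y hy ⟨s, r, hs, hr, hsr, hqs⟩
    rw [segment_symm, segment_eq_image'] at hx hy
    obtain ⟨α, ⟨hα, -⟩, rfl⟩ := hx
    obtain ⟨β, ⟨hβ, -⟩, rfl⟩ := hy
    have hz : (s * α + r * β) • (p - q) = 0 := by
      have : s • (q + α • (p - q)) + r • (q + β • (p - q))
          = (s + r) • q + (s * α + r * β) • (p - q) := by module
      rw [this, hsr, one_smul] at hqs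
      simpa using hqs
    rcases smul_eq_zero.1 hz with h0 | h0
    · have : α = 0 := by
        have h1 := mul_nonneg hs.le hα
        have h2 := mul_nonneg hr.le hβ
        have h3 : s * α = 0 := by linarith
        exact (mul_eq_zero.1 h3).resolve_left hs.ne'
      simp [this]
    · simp [h0]

/-- In a contact system, an endpoint of a segment is not interior to a parallel segment. -/
lemma IsContactSystem.right_not_mem_openSegment_of_parallel {L : Set (Set Pt)}
    (hL : IsContactSystem L) {p q a b : Pt} (hpq : p ≠ q) (hab : a ≠ b)
    (hl : segment ℝ p q ∈ L) (hm : segment ℝ a b ∈ L) {e : ℝ} (he : q - p = e • (b - a)) :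
    q ∉ openSegment ℝ a b := by
  intro hq
  refine right_not_mem_openSegment_of_segment_eq (p := p) hab ?_ hq
  rw [openSegment_eq_image'] at hq
  obtain ⟨s, ⟨hs0, hs1⟩, hs⟩ := hq
  have hss : 0 < s * (1 - s) := mul_pos hs0 (sub_pos.2 hs1)
  have hden : 0 < 1 + |e| := by positivity
  obtain ⟨ε, hε⟩ : ∃ ε, ε = s * (1 - s) / (1 + |e|) := ⟨_, rfl⟩
  have hεmul : ε * (1 + |e|) = s * (1 - s) := by rw [hε]; field_simp
  have hε0 : 0 < ε := hε ▸ div_pos hss hden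
  have habs : |ε * e| < s * (1 - s) := by
    rw [abs_mul, abs_of_pos hε0]; linarith
  have hε1 : ε < 1 := by nlinarith [mul_nonneg hε0.le (abs_nonneg e)]
  have hb := abs_lt.1 habs
  refine hL.2 (q - ε • (q - p)) _ hl _ hm
    (isIntPt_of_mem_openSegment hpq ?_) (isIntPt_of_mem_openSegment hab ?_)
  · rw [openSegment_eq_image']
    exact ⟨1 - ε, ⟨by linarith, by linarith⟩, by module⟩
  · rw [openSegment_eq_image']
    refine ⟨s - ε * e, ⟨by nlinarith, by nlinarith⟩, ?_⟩
    rw [he, ← hs]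
    module

lemma zpow_apply_of_translation {t : Iso2} {v : Pt} (ht : ∀ x, t x = x + v) (n : ℤ) (x : Pt) :
    (t ^ n) x = x + (n : ℝ) • v := by
  induction n with
  | zero => simp
  | succ n ih =>
    rw [← mul_self_zpow, AffineIsometryEquiv.coe_mul, Function.comp_apply, ht, ih]
    push_cast; module
  | pred n ih =>
    have h : t ((t ^ (-(n : ℤ) - 1)) x) = (t ^ (-(n : ℤ))) x := by
      rw [← Function.comp_apply (f := t), ← AffineIsometryEquiv.coe_mul, mul_self_zpow, sub_add_cancel]
    rw [ht, ih] at h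
    rw [eq_sub_of_add_eq h]
    push_cast; module

lemma image_segment_isometry (g : Iso2) (p q : Pt) :
    (⇑g) '' segment ℝ p q = segment ℝ (g p) (g q) :=
  image_segment ℝ g.toAffineEquiv.toAffineMap p q

/-- A linear functional on the plane whose kernel is the line spanned by a nonzero `v`. -/
lemma exists_functional_ker {v : Pt} (hv : v ≠ 0) :
    ∃ Y : Pt →L[ℝ] ℝ, Y v = 0 ∧ ∀ z, Y z = 0 → ∃ c : ℝ, z = c • v := by
  refine ⟨v 0 • EuclideanSpace.proj 1 - v 1 • EuclideanSpace.proj 0, ?_, fun z hz => ?_⟩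
  · simp [mul_comm]
  · replace hz : v 0 * z 1 - v 1 * z 0 = 0 := hz
    by_cases h0 : v 0 = 0
    · have h1 : v 1 ≠ 0 := fun h1 => hv (by ext i; fin_cases i <;> simp [h0, h1])
      have hz0 : z 0 = 0 := by simpa [h0, h1] using hz
      refine ⟨z 1 / v 1, ?_⟩
      ext i; fin_cases i
      · simp [h0, hz0]
      · simp [h1]
    · refine ⟨z 0 / v 0, ?_⟩
      ext i; fin_cases i
      · simp [h0]
      · simp only [Fin.mk_one, PiLp.smul_apply, smul_eq_mul]
        field_simp
        linarith

/-- If a maximum of a linear functional over a segment is attained at an interior point, it is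
attained at both endpoints. -/
lemma eq_of_mem_openSegment_of_le {Y : Pt →L[ℝ] ℝ} {a b x : Pt} (hx : x ∈ openSegment ℝ a b)
    (ha : Y a ≤ Y x) (hb : Y b ≤ Y x) : Y a = Y x ∧ Y b = Y x := by
  obtain ⟨s, r, hs, hr, hsr, rfl⟩ := hx
  simp only [map_add, map_smul, smul_eq_mul] at *
  obtain rfl : s = 1 - r := by linarith
  constructor <;> nlinarith

section

variable {t : Iso2} {v : Pt} {L M : Set (Set Pt)} {Y : Pt →L[ℝ] ℝ}

/-- The right endpoint of a segment parallel to `ker Y` at which `Y` is maximal is free. -/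
lemma isFreeEndpt_right_of_level (hL : IsContactSystem L) (hML : M ⊆ L)
    (hY : ∀ z, Y z = 0 → ∃ c : ℝ, z = c • v) {p q : Pt} (hpq : p ≠ q)
    (hl : segment ℝ p q ∈ M) (hYpq : Y p = Y q) (hmax : ∀ m ∈ M, ∀ z ∈ m, Y z ≤ Y q) :
    IsFreeEndpt q M := by
  refine ⟨⟨_, hl, p, q, hpq, rfl, Or.inr rfl⟩, ?_⟩
  rintro _ hm ⟨a, b, hab, rfl, hq⟩
  obtain ⟨ha, hb⟩ := eq_of_mem_openSegment_of_le hq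
    (hmax _ hm _ (left_mem_segment ℝ a b)) (hmax _ hm _ (right_mem_segment ℝ a b))
  obtain ⟨c, hc⟩ := hY (b - a) (by simp [ha, hb])
  obtain ⟨d, hd⟩ := hY (q - p) (by simp [hYpq])
  have hc0 : c ≠ 0 := by
    rintro rfl
    exact hab (sub_eq_zero.1 (by simpa using hc)).symm
  refine hL.right_not_mem_openSegment_of_parallel (e := d / c) hpq hab (hML hl) (hML hm) ?_ hq
  rw [hc, hd, smul_smul, div_mul_cancel₀ _ hc0]

/-- The endpoints of a segment of a generic symmetric contact system are in distinct orbits. -/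
lemma endpoints_not_mem_orbit (ht : ∀ x, t x = x + v) (hL : IsGenericCS L)
    (hS : SatS1 (Subgroup.zpowers t) L) {p q : Pt} (hpq : p ≠ q) (hl : segment ℝ p q ∈ L)
    (n : ℤ) : q ≠ (t ^ n) p := by
  intro hq
  have hmem := hS _ hl (t ^ n) (Subgroup.zpow_mem_zpowers t n)
  rw [image_segment_isometry, ← hq] at hmem
  have hne : q ≠ (t ^ n) q := fun h => hpq ((t ^ n).injective (hq.symm.trans h))
  have heq := hL.2 q _ hl _ hmem ⟨p, q, hpq, rfl, Or.inr rfl⟩ ⟨_, _, hne, rfl, Or.inl rfl⟩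
  have hin : (t ^ n) q ∈ segment ℝ p q := heq ▸ right_mem_segment ℝ _ _
  rw [zpow_apply_of_translation ht] at hin hq
  rw [segment_eq_image'] at hin
  obtain ⟨s, ⟨-, hs1⟩, hs⟩ := hin
  have h0 : (2 - s) • (q - p) = 0 := by
    have h1 : (n : ℝ) • v = q - p := by rw [eq_sub_iff_add_eq, add_comm, ← hq]
    rw [h1] at hs
    linear_combination (norm := module) -hs
  rcases smul_eq_zero.1 h0 with h | h
  · linarith
  · exact hpq (sub_eq_zero.1 h).symm

lemma exists_free_pair_of_level (ht : ∀ x, t x = x + v) (hL : IsGenericCS L)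
    (hS : SatS1 (Subgroup.zpowers t) L) (hML : M ⊆ L)
    (hY : ∀ z, Y z = 0 → ∃ c : ℝ, z = c • v) {p q : Pt} (hpq : p ≠ q)
    (hl : segment ℝ p q ∈ M) (hYpq : Y p = Y q) (hmax : ∀ m ∈ M, ∀ z ∈ m, Y z ≤ Y q) :
    ∃ p q : Pt, IsFreeEndpt p M ∧ IsFreeEndpt q M ∧ ∀ n : ℤ, q ≠ (t ^ n) p :=
  ⟨p, q, isFreeEndpt_right_of_level hL.1 hML hY hpq.symm (segment_symm ℝ p q ▸ hl) hYpq.symm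
      (by rwa [hYpq]),
    isFreeEndpt_right_of_level hL.1 hML hY hpq hl hYpq hmax,
    endpoints_not_mem_orbit ht hL hS hpq (hML hl)⟩

/-- An invariant functional attains its maximum over an invariant family at an endpoint. -/
lemma exists_segment_max (hL : IsContactSystem L)
    (hS : SatS2 (Subgroup.zpowers t) L) (hML : M ⊆ L) (hne : M.Nonempty)
    (hM : ∀ l ∈ M, ∀ g ∈ Subgroup.zpowers t, (⇑g) '' l ∈ M)
    (hYt : ∀ g ∈ Subgroup.zpowers t, ∀ x, Y (g x) = Y x) :
    ∃ p q : Pt, p ≠ q ∧ segment ℝ p q ∈ M ∧ ∀ m ∈ M, ∀ z ∈ m, Y z ≤ Y q := by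
  obtain ⟨T, hT, -, hTL⟩ := hS
  have hrep : ∀ m ∈ M, ∃ τ ∈ T ∩ M, ∃ g ∈ Subgroup.zpowers t, (⇑g) '' τ = m := by
    intro m hm
    obtain ⟨τ, hτ, g, hg, rfl⟩ := hTL m (hML hm)
    refine ⟨τ, ⟨hτ, ?_⟩, g, hg, rfl⟩
    convert hM _ hm g⁻¹ (inv_mem hg) using 1
    simp [Set.image_image]
  have hcpt : IsCompact (⋃ τ ∈ T ∩ M, τ) := by
    refine (hT.inter_of_left M).isCompact_biUnion fun τ hτ => ?_
    obtain ⟨p, q, -, rfl⟩ := hL.1 τ (hML hτ.2)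
    rw [← convexHull_pair]
    exact (Set.toFinite {p, q}).isCompact_convexHull ℝ
  have hne' : (⋃ τ ∈ T ∩ M, τ).Nonempty := by
    obtain ⟨m, hm⟩ := hne
    obtain ⟨τ, hτ, -⟩ := hrep m hm
    obtain ⟨p, q, -, rfl⟩ := hL.1 τ (hML hτ.2)
    exact ⟨p, Set.mem_biUnion hτ (left_mem_segment ℝ p q)⟩
  obtain ⟨z, hz, hzmax⟩ := hcpt.exists_isMaxOn hne' Y.continuous.continuousOn
  have hglobal : ∀ m ∈ M, ∀ x ∈ m, Y x ≤ Y z := by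
    intro m hm x hx
    obtain ⟨τ, hτ, g, hg, rfl⟩ := hrep m hm
    obtain ⟨y, hy, rfl⟩ := hx
    rw [hYt g hg]
    exact hzmax (Set.mem_biUnion hτ hy)
  obtain ⟨τ, hτ, hzτ⟩ := Set.mem_iUnion₂.1 hz
  obtain ⟨p, q, hpq, rfl⟩ := hL.1 τ (hML hτ.2)
  have hle : Y z ≤ max (Y p) (Y q) :=
    (Y.toLinearMap.convexOn convex_univ).le_max_of_mem_segment (Set.mem_univ p) (Set.mem_univ q)
      hzτ
  rcases le_max_iff.1 hle with h | h
  · exact ⟨q, p, hpq.symm, segment_symm ℝ p q ▸ hτ.2, fun m hm x hx => (hglobal m hm x hx).trans h⟩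
  · exact ⟨p, q, hpq, hτ.2, fun m hm x hx => (hglobal m hm x hx).trans h⟩

/-- Either there are free endpoints in two orbits, or `Y` is maximal at a free endpoint of a
segment on which `Y` is not constant. -/
lemma exists_free_pair_or_free_max (ht : ∀ x, t x = x + v) (hL : IsGenericCS L)
    (hS1 : SatS1 (Subgroup.zpowers t) L) (hS2 : SatS2 (Subgroup.zpowers t) L)
    (hML : M ⊆ L) (hne : M.Nonempty)
    (hM : ∀ l ∈ M, ∀ g ∈ Subgroup.zpowers t, (⇑g) '' l ∈ M)
    (hYt : ∀ g ∈ Subgroup.zpowers t, ∀ x, Y (g x) = Y x)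
    (hY : ∀ z, Y z = 0 → ∃ c : ℝ, z = c • v) :
    (∃ p q : Pt, IsFreeEndpt p M ∧ IsFreeEndpt q M ∧ ∀ n : ℤ, q ≠ (t ^ n) p) ∨
      ∃ p q : Pt, IsFreeEndpt q M ∧ segment ℝ p q ∈ M ∧ Y p < Y q ∧
        ∀ m ∈ M, ∀ z ∈ m, Y z ≤ Y q := by
  obtain ⟨p, q, hpq, hl, hmax⟩ := exists_segment_max hL.1 hS2 hML hne hM hYt
  by_cases hfree : IsFreeEndpt q M
  · rcases (hmax _ hl p (left_mem_segment ℝ p q)).lt_or_eq with h | h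
    · exact Or.inr ⟨p, q, hfree, hl, h, hmax⟩
    · exact Or.inl (exists_free_pair_of_level ht hL hS1 hML hY hpq hl h hmax)
  · obtain ⟨m, hm, a, b, hab, rfl, hq⟩ : ∃ m ∈ M, IsIntPt q m := by
      by_contra! h
      exact hfree ⟨⟨_, hl, p, q, hpq, rfl, Or.inr rfl⟩, h⟩
    obtain ⟨ha, hb⟩ := eq_of_mem_openSegment_of_le hq
      (hmax _ hm _ (left_mem_segment ℝ a b)) (hmax _ hm _ (right_mem_segment ℝ a b))
    exact Or.inl (exists_free_pair_of_level ht hL hS1 hML hY hab hm (ha.trans hb.symm)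
      (by rwa [hb]))

end

/-- For `Γ` the infinite cyclic group generated by a
translation `t`, every nonempty `Γ`-invariant subset of a generic
`Γ`-symmetric contact system has free endpoints in at least two distinct
`Γ`-orbits. -/
theorem stmt_7 (t : Iso2) (ht : IsTranslation t)
    (L : Set (Set Pt)) (hL : IsGenSymmCS (Subgroup.zpowers t) L) :
    ∀ M ⊆ L, M.Nonempty →
      (∀ l ∈ M, ∀ g ∈ Subgroup.zpowers t, (⇑g) '' l ∈ M) →
      ∃ p q : Pt, IsFreeEndpt p M ∧ IsFreeEndpt q M ∧ ∀ n : ℤ, q ≠ (t ^ n) p := by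
  intro M hML hne hM
  obtain ⟨v, hv, htv⟩ := ht
  obtain ⟨hG, hS1, hS2, -⟩ := hL
  obtain ⟨Y, hYv, hY⟩ := exists_functional_ker hv
  have hYt : ∀ g ∈ Subgroup.zpowers t, ∀ x, Y (g x) = Y x := by
    rintro _ ⟨n, rfl⟩ x
    simp [zpow_apply_of_translation htv, hYv]
  rcases exists_free_pair_or_free_max htv hG hS1 hS2 hML hne hM hYt hY with
    h | ⟨a, p, hp, hl, hlt, hmax⟩
  · exact h
  rcases exists_free_pair_or_free_max (Y := -Y) htv hG hS1 hS2 hML hne hM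
    (by simpa using hYt) (by simpa using hY) with h | ⟨-, q, hq, -, -, hmin⟩
  · exact h
  refine ⟨p, q, hp, hq, fun n hn => ?_⟩
  have h1 := hYt _ (Subgroup.zpow_mem_zpowers t n) p
  rw [← hn] at h1
  have h2 := hmin _ hl a (left_mem_segment ℝ a p)
  simp only [neg_apply] at h2
  linarith
end
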